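/- arXiv:2011.11579 — 3 statements merged into one kernel-verified Lean document; each statement's English description precedes it below -/
import Mathlib

section
/- Let 0 < ε < 2, and let B' be the two-point configuration {y₁, y₂} in ℝ² with y₁ = (1, 2), y₂ = (b, d'), b = √2·(1/2 − ε/4) + 1, d' = √2·(1/2 + ε/4) + 2. Then y₁ has persistence 1 and y₂ has persistence 1 + √2·ε/2; the Euclidean distance √(1 + ε²/4) between y₁ and y₂ exceeds 1 but is less than 1 + √2·ε/2. Consequently the number of points of B' in the disk D'₁ (centered at y₁, radius 1) is 1, and the number of points of B' in the disk D'₂ (centered at y₂, radius 1 + √2·ε/2) is 2; i.e. the interconnectivity vector of B' is ⟨2, 1⟩ after sorting in decreasing order. -/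
/-- `inDisk p c r` : the point `p ∈ ℝ²` lies in the open Euclidean disk of radius `r`
centered at `c`. -/
def inDisk (p c : ℝ × ℝ) (r : ℝ) : Prop :=
  (p.1 - c.1) ^ 2 + (p.2 - c.2) ^ 2 < r ^ 2

/-- For `0 < ε < 2`, the two-point configuration `B' = {y₁, y₂}` with `y₁ = (1,2)`,
`y₂ = (b, d')`, `b = √2·(1/2 − ε/4) + 1`, `d' = √2·(1/2 + ε/4) + 2` has: `y₁` of
persistence `1`, `y₂` of persistence `1 + √2·ε/2`, the distance `√(1 + ε²/4)` between the
points exceeding `1` but smaller than `1 + √2·ε/2`; consequently the disk `D'₁` (center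
`y₁`, radius `1`) contains exactly one point of `B'` and the disk `D'₂` (center `y₂`,
radius `1 + √2·ε/2`) contains exactly two points of `B'`: the interconnectivity vector of
`B'` sorted decreasingly is `⟨2, 1⟩`. -/
theorem interconnectivity_vector_of_B' (ε b d' : ℝ) (hε0 : 0 < ε) (hε2 : ε < 2)
    (hb : b = Real.sqrt 2 * (1 / 2 - ε / 4) + 1)
    (hd' : d' = Real.sqrt 2 * (1 / 2 + ε / 4) + 2) :
    (2 : ℝ) - 1 = 1 ∧
    d' - b = 1 + Real.sqrt 2 * ε / 2 ∧
    Real.sqrt ((1 - b) ^ 2 + (2 - d') ^ 2) = Real.sqrt (1 + ε ^ 2 / 4) ∧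
    1 < Real.sqrt (1 + ε ^ 2 / 4) ∧
    Real.sqrt (1 + ε ^ 2 / 4) < 1 + Real.sqrt 2 * ε / 2 ∧
    {p ∈ ({((1 : ℝ), (2 : ℝ)), (b, d')} : Set (ℝ × ℝ)) |
        inDisk p ((1 : ℝ), (2 : ℝ)) (2 - 1)}.ncard = 1 ∧
    {p ∈ ({((1 : ℝ), (2 : ℝ)), (b, d')} : Set (ℝ × ℝ)) |
        inDisk p (b, d') (d' - b)}.ncard = 2 := by
  have h2 : Real.sqrt 2 ^ 2 = 2 := Real.sq_sqrt (by norm_num)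
  have hpos : 0 < Real.sqrt 2 := Real.sqrt_pos.mpr (by norm_num)
  have hdist : (1 - b) ^ 2 + (2 - d') ^ 2 = 1 + ε ^ 2 / 4 := by
    subst hb hd'
    linear_combination (1 / 2 + ε ^ 2 / 8) * h2
  have hper : d' - b = 1 + Real.sqrt 2 * ε / 2 := by
    subst hb hd'
    ring
  have he : 0 < ε ^ 2 := by positivity
  have hse : 0 < Real.sqrt 2 * ε := by positivity
  have hlt : 1 + ε ^ 2 / 4 < (1 + Real.sqrt 2 * ε / 2) ^ 2 := by
    have h : (1 + Real.sqrt 2 * ε / 2) ^ 2 = 1 + Real.sqrt 2 * ε + ε ^ 2 / 2 := by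
      linear_combination (ε ^ 2 / 4) * h2
    rw [h]
    linarith
  have hne : ((1 : ℝ), (2 : ℝ)) ≠ (b, d') := by
    intro h
    have h1 : 1 = b := congrArg Prod.fst h
    have h3 : 2 = d' := congrArg Prod.snd h
    rw [← h1, ← h3] at hdist
    norm_num at hdist
    linarith
  refine ⟨by norm_num, hper, by rw [hdist], ?_, ?_, ?_, ?_⟩
  · rw [Real.lt_sqrt (by norm_num)]
    linarith
  · rw [Real.sqrt_lt' (by positivity)]
    exact hlt
  · rw [Set.ncard_eq_one]
    refine ⟨((1 : ℝ), (2 : ℝ)), ?_⟩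
    ext p
    simp only [Set.mem_setOf_eq, Set.mem_insert_iff, Set.mem_singleton_iff]
    constructor
    · rintro ⟨h | h, hp⟩
      · exact h
      · exfalso
        subst h
        simp only [inDisk] at hp
        nlinarith
    · intro h
      subst h
      exact ⟨Or.inl rfl, by norm_num [inDisk]⟩
  · rw [← Set.ncard_pair hne]
    congr 1
    ext p
    simp only [Set.mem_setOf_eq, Set.mem_insert_iff, Set.mem_singleton_iff]
    constructor
    · exact fun h => h.1
    · intro h
      refine ⟨h, ?_⟩
      rcases h with h | h
      · subst h
        simp only [inDisk]
        rw [hdist, hper]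
        exact hlt
      · subst h
        simp only [inDisk]
        rw [hper]
        nlinarith
end

section
/- (Instability of the interconnectivity vector.) For every constant C ≥ 0 there exists ε with 0 < ε < 2 such that, taking B = {(1,2), (b,d)} and B' = {(1,2), (b,d')} with b = √2·(1/2 − ε/4) + 1, d = √2·(1/2 − ε/4) + 2, d' = √2·(1/2 + ε/4) + 2, the interconnectivity vectors satisfy v(B) = ⟨2,2⟩ and v(B') = ⟨2,1⟩ (sorted decreasingly), so that ‖v(B) − v(B')‖_∞ = 1, while the matching of B to B' that fixes (1,2) and sends (b,d) to (b,d') has total ∞-norm cost ‖(b,d) − (b,d')‖_∞ = √2·ε/2, and 1 > C·(√2·ε/2). Hence there is no constant C ≥ 0 with ‖v(B) − v(B')‖_∞ ≤ C·W₁(B,B') for all persistence diagrams, since W₁(B,B') ≤ √2·ε/2. -/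
/-- Instability of the interconnectivity vector: for every constant `C ≥ 0` there is
`0 < ε < 2` such that, with `B = {(1,2), (b,d)}` and `B' = {(1,2), (b,d')}` where
`b = √2·(1/2 − ε/4) + 1`, `d = √2·(1/2 − ε/4) + 2`, `d' = √2·(1/2 + ε/4) + 2`, the
interconnectivity vector of `B` is `⟨2,2⟩` and that of `B'` is `⟨2,1⟩` (so the sup-norm
of their difference is `1`), while the matching fixing `(1,2)` and sending `(b,d)` to
`(b,d')` has ∞-norm cost `√2·ε/2`, and `1 > C·(√2·ε/2)`.  Hence no constant `C` can give
`‖v(B) − v(B')‖_∞ ≤ C·W₁(B,B')`, since `W₁(B,B') ≤ √2·ε/2`. -/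
theorem interconnectivity_vector_unstable (C : ℝ) (hC : 0 ≤ C) :
    ∃ ε : ℝ, 0 < ε ∧ ε < 2 ∧
      ∀ b d d' : ℝ,
        b = Real.sqrt 2 * (1 / 2 - ε / 4) + 1 →
        d = Real.sqrt 2 * (1 / 2 - ε / 4) + 2 →
        d' = Real.sqrt 2 * (1 / 2 + ε / 4) + 2 →
        -- interconnectivity vector of B is ⟨2, 2⟩
        {p ∈ ({((1 : ℝ), (2 : ℝ)), (b, d)} : Set (ℝ × ℝ)) |
            inDisk p ((1 : ℝ), (2 : ℝ)) (2 - 1)}.ncard = 2 ∧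
        {p ∈ ({((1 : ℝ), (2 : ℝ)), (b, d)} : Set (ℝ × ℝ)) |
            inDisk p (b, d) (d - b)}.ncard = 2 ∧
        -- interconnectivity vector of B' is ⟨2, 1⟩ (sorted decreasingly)
        {p ∈ ({((1 : ℝ), (2 : ℝ)), (b, d')} : Set (ℝ × ℝ)) |
            inDisk p (b, d') (d' - b)}.ncard = 2 ∧
        {p ∈ ({((1 : ℝ), (2 : ℝ)), (b, d')} : Set (ℝ × ℝ)) |
            inDisk p ((1 : ℝ), (2 : ℝ)) (2 - 1)}.ncard = 1 ∧
        -- the sup-norm of the difference of the sorted vectors is 1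
        max |(2 : ℝ) - 2| |(2 : ℝ) - 1| = 1 ∧
        -- the matching cost of the obvious matching is √2·ε/2
        max |(1 : ℝ) - 1| |(2 : ℝ) - 2| + max |b - b| |d - d'| = Real.sqrt 2 * ε / 2 ∧
        -- and 1 exceeds C times that cost
        1 > C * (Real.sqrt 2 * ε / 2) := by
  have hs : Real.sqrt 2 ^ 2 = 2 := Real.sq_sqrt (by norm_num)
  have hs0 : 0 < Real.sqrt 2 := Real.sqrt_pos.mpr (by norm_num)
  have hs2 : Real.sqrt 2 < 2 := by nlinarith
  obtain ⟨ε, he⟩ : ∃ ε : ℝ, ε = 1 / (1 + C) := ⟨_, rfl⟩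
  have he0 : 0 < ε := by rw [he]; positivity
  have heC : ε * (1 + C) = 1 := by rw [he]; field_simp
  have he1 : ε ≤ 1 := by nlinarith
  have hse : 0 < Real.sqrt 2 * ε := mul_pos hs0 he0
  refine ⟨ε, he0, by linarith, ?_⟩
  intro b d d' hb hd hd'
  have hb1 : 1 < b := by
    have : 0 < Real.sqrt 2 * (1 / 2 - ε / 4) := mul_pos hs0 (by linarith)
    linarith
  have q1 : (b - 1) ^ 2 = 2 * (1 / 2 - ε / 4) ^ 2 := by
    rw [hb]; linear_combination (1 / 2 - ε / 4) ^ 2 * hs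
  have q2 : (d - 2) ^ 2 = 2 * (1 / 2 - ε / 4) ^ 2 := by
    rw [hd]; linear_combination (1 / 2 - ε / 4) ^ 2 * hs
  have q3 : (d' - 2) ^ 2 = 2 * (1 / 2 + ε / 4) ^ 2 := by
    rw [hd']; linear_combination (1 / 2 + ε / 4) ^ 2 * hs
  have r1 : d - b = 1 := by rw [hd, hb]; ring
  have r2 : d' - b = 1 + Real.sqrt 2 * ε / 2 := by rw [hd', hb]; ring
  have r3 : (d' - b) ^ 2 = 1 + Real.sqrt 2 * ε + ε ^ 2 / 2 := by
    rw [r2]; linear_combination (ε ^ 2 / 4) * hs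
  have ne : ∀ y : ℝ, ((1 : ℝ), (2 : ℝ)) ≠ (b, y) := by
    intro y h
    have := congrArg Prod.fst h
    simp only at this
    linarith
  have two : ∀ (y : ℝ) (c : ℝ × ℝ) (r : ℝ), inDisk (1, 2) c r → inDisk (b, y) c r →
      {p ∈ ({((1 : ℝ), (2 : ℝ)), (b, y)} : Set (ℝ × ℝ)) | inDisk p c r}.ncard = 2 := by
    intro y c r h1 h2
    have : {p ∈ ({((1 : ℝ), (2 : ℝ)), (b, y)} : Set (ℝ × ℝ)) | inDisk p c r}
        = {((1 : ℝ), (2 : ℝ)), (b, y)} := by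
      apply Set.sep_eq_self_iff_mem_true.mpr
      rintro p (rfl | rfl)
      · exact h1
      · exact h2
    rw [this, Set.ncard_pair (ne y)]
  refine ⟨two _ _ _ ?_ ?_, two _ _ _ ?_ ?_, two _ _ _ ?_ ?_, ?_, by norm_num, ?_, ?_⟩
  · simp only [inDisk]; norm_num
  · simp only [inDisk]; nlinarith
  · simp only [inDisk]; rw [r1]; nlinarith
  · simp only [inDisk]; rw [r1]; norm_num
  · simp only [inDisk]; rw [r3]; nlinarith
  · simp only [inDisk]; rw [r3]; nlinarith
  · have : {p ∈ ({((1 : ℝ), (2 : ℝ)), (b, d')} : Set (ℝ × ℝ)) |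
        inDisk p ((1 : ℝ), (2 : ℝ)) (2 - 1)} = {((1 : ℝ), (2 : ℝ))} := by
      ext p
      simp only [Set.mem_ofPred_eq, Set.mem_insert_iff, Set.mem_singleton_iff]
      constructor
      · rintro ⟨rfl | rfl, h⟩
        · rfl
        · exfalso
          simp only [inDisk] at h
          nlinarith
      · rintro rfl
        refine ⟨Or.inl rfl, ?_⟩
        simp only [inDisk]; norm_num
    rw [this, Set.ncard_singleton]
  · have h : d - d' = -(Real.sqrt 2 * ε / 2) := by rw [hd, hd']; ring
    have h2 : 0 < Real.sqrt 2 * ε / 2 := by linarith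
    rw [h, abs_neg, abs_of_pos h2]
    simp [h2.le]
  · have h1 : C * ε < 1 := by linarith
    have h0 : 0 ≤ C * ε := by positivity
    show C * (Real.sqrt 2 * ε / 2) < 1
    have h3 : C * ε * Real.sqrt 2 ≤ C * ε * 2 := mul_le_mul_of_nonneg_left hs2.le h0
    linarith
end

section
/- (Stability of the stable interconnectivity vector.) Let N ≥ 1, δ > 0, and let x₁,…,x_N ∈ ℝ² with x_i = (b_i, d_i), b_i < d_i. Set σ_i = d_i − b_i + δ, w_i = 1/N, and let p_i(x) = exp(−‖x − x_i‖²/(2σ_i))/(2πσ_i) be the Gaussian density with mean x_i and covariance σ_i·I. Let L_i be a Lipschitz constant of p_i with respect to the ∞-norm on ℝ² (such L_i exists; e.g. L_i = √2·e^{−1/2}/(2π σ_i^{3/2})), and set C = max_{1≤i≤N} w_i·L_i. Then for every family y₁,…,y_N ∈ ℝ² (the points of a perturbed diagram matched to x₁,…,x_N), one has max_{1≤i≤N} | w_i·Σ_{j=1}^N p_i(x_j) − w_i·Σ_{j=1}^N p_i(y_j) | ≤ C · Σ_{j=1}^N ‖x_j − y_j‖_∞. In particular, the stable interconnectivity vector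 satisfies ‖v^s(B) − v^s(B')‖_∞ ≤ C·W₁(B,B') when v^s(B') is evaluated along the matching realizing W₁(B,B'). -/
/-- Stability of the stable interconnectivity vector: with Gaussian densities `p_i`
centered at the diagram points `x_i` with covariance `σ_i·I`, `σ_i = d_i − b_i + δ`,
weights `w_i = 1/N`, `L_i` an ∞-norm Lipschitz constant for `p_i` and
`C = max_i w_i·L_i`, every entry of the difference of the stable interconnectivity
vectors computed from `x₁,…,x_N` and from a matched family `y₁,…,y_N` is bounded by
`C · Σ_j ‖x_j − y_j‖_∞`. -/
theorem stable_interconnectivity_vector_stability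
    (N : ℕ) (hN : 1 ≤ N) (δ : ℝ) (hδ : 0 < δ)
    (x : Fin N → ℝ × ℝ) (hx : ∀ i, (x i).1 < (x i).2)
    (σ : Fin N → ℝ) (hσ : ∀ i, σ i = (x i).2 - (x i).1 + δ)
    (p : Fin N → ℝ × ℝ → ℝ)
    (hp : ∀ i z, p i z =
      Real.exp (-((z.1 - (x i).1) ^ 2 + (z.2 - (x i).2) ^ 2) / (2 * σ i)) /
        (2 * Real.pi * σ i))
    (L : Fin N → ℝ)
    (hL : ∀ i z w, |p i z - p i w| ≤ L i * max |z.1 - w.1| |z.2 - w.2|)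
    (C : ℝ)
    (hC : C = Finset.univ.sup' (Finset.univ_nonempty_iff.mpr ⟨⟨0, hN⟩⟩)
      fun i => (1 / (N : ℝ)) * L i)
    (y : Fin N → ℝ × ℝ) :
    ∀ i, |(1 / (N : ℝ)) * ∑ j, p i (x j) - (1 / (N : ℝ)) * ∑ j, p i (y j)| ≤
      C * ∑ j, max |(x j).1 - (y j).1| |(x j).2 - (y j).2| := by
  intro i
  have hle : (1 / (N : ℝ)) * L i ≤ C := by
    rw [hC]
    exact Finset.le_sup' (fun i => (1 / (N : ℝ)) * L i) (Finset.mem_univ i)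
  have hw : (0 : ℝ) ≤ 1 / (N : ℝ) := by positivity
  have hS : 0 ≤ ∑ j, max |(x j).1 - (y j).1| |(x j).2 - (y j).2| :=
    Finset.sum_nonneg fun j _ => le_max_of_le_left (abs_nonneg _)
  rw [← mul_sub, ← Finset.sum_sub_distrib, abs_mul, abs_of_nonneg hw]
  calc (1 / (N : ℝ)) * |∑ j, (p i (x j) - p i (y j))|
      ≤ (1 / (N : ℝ)) * ∑ j, L i * max |(x j).1 - (y j).1| |(x j).2 - (y j).2| :=
        mul_le_mul_of_nonneg_left ((Finset.abs_sum_le_sum_abs _ _).trans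
          (Finset.sum_le_sum fun j _ => hL i (x j) (y j))) hw
    _ = ((1 / (N : ℝ)) * L i) * ∑ j, max |(x j).1 - (y j).1| |(x j).2 - (y j).2| := by
        rw [← Finset.mul_sum, mul_assoc]
    _ ≤ _ := mul_le_mul_of_nonneg_right hle hS
end
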